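/- arXiv:1706.03651 — 3 statements merged into one kernel-verified Lean document; each statement's English description precedes it below -/
import Mathlib

section
/- For every real number x ≥ 2.11, one has (x² − 3.85x + 14.15)·P_1(x)/2 − 2.85·P_2(x)/3 + P_3(x)/12 − (x² − 3.85x + 14.15)·P_2(x)/(6·e^x) − P_4(x)/(20·e^x) ≥ 0. -/
theorem stmt12 (x : ℝ) (hx : 2.11 ≤ x)
    (P₁ : ℝ → ℝ) (hP₁ : P₁ = fun x : ℝ => 3 * x ^ 2 - 6 * x + 5)
    (P₂ : ℝ → ℝ) (hP₂ : P₂ = fun x : ℝ => 5 * x ^ 3 - 24 * x ^ 2 + 39 * x - 14)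
    (P₃ : ℝ → ℝ) (hP₃ : P₃ = fun x : ℝ => 7 * x ^ 4 - 48 * x ^ 3 + 120 * x ^ 2 - 124 * x + 51)
    (P₄ : ℝ → ℝ) (hP₄ : P₄ = fun x : ℝ => 9 * x ^ 5 - 80 * x ^ 4 + 280 * x ^ 3 - 480 * x ^ 2 + 405 * x - 124) :
    (x ^ 2 - 3.85 * x + 14.15) * P₁ x / 2 - 2.85 * P₂ x / 3 + P₃ x / 12
      - (x ^ 2 - 3.85 * x + 14.15) * P₂ x / (6 * Real.exp x)
      - P₄ x / (20 * Real.exp x) ≥ 0 := by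
  subst hP₁ hP₂ hP₃ hP₄
  dsimp only
  obtain ⟨t, ht, rfl⟩ : ∃ t : ℝ, 0 ≤ t ∧ x = 2.11 + t := ⟨x - 2.11, by linarith, by ring⟩
  set y := 2.11 + t with hy
  set q := y ^ 2 - 3.85 * y + 14.15 with hq
  set A := q * (3 * y ^ 2 - 6 * y + 5) / 2 - 2.85 * (5 * y ^ 3 - 24 * y ^ 2 + 39 * y - 14) / 3
    + (7 * y ^ 4 - 48 * y ^ 3 + 120 * y ^ 2 - 124 * y + 51) / 12 with hA
  set B := q * (5 * y ^ 3 - 24 * y ^ 2 + 39 * y - 14) / 6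
    + (9 * y ^ 5 - 80 * y ^ 4 + 280 * y ^ 3 - 480 * y ^ 2 + 405 * y - 124) / 20 with hB
  have hA_nonneg : 0 ≤ A := by
    rw [hA, hq, hy]
    ring_nf
    positivity
  have hB_le : 0 ≤ A * (y + 1) - B := by
    rw [hA, hB, hq, hy]
    ring_nf
    positivity
  have hexp : B ≤ A * Real.exp y := by
    linarith [mul_le_mul_of_nonneg_left (Real.add_one_le_exp y) hA_nonneg]
  have hdiv : B / Real.exp y ≤ A := (div_le_iff₀ (Real.exp_pos y)).2 hexp
  have hsplit : B / Real.exp y = q * (5 * y ^ 3 - 24 * y ^ 2 + 39 * y - 14) / (6 * Real.exp y)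
      + (9 * y ^ 5 - 80 * y ^ 4 + 280 * y ^ 3 - 480 * y ^ 2 + 405 * y - 124)
        / (20 * Real.exp y) := by
    rw [hB, add_div, div_div, div_div]
  linarith
end

section
/- For every integer n ≥ 17, writing w = log log n, one has P_9(w)·P_12(w)/(4·log⁷ n · log p_n) + 12.85·P_10(w)/(2·log⁷ n · log p_n) + 3.15·P_11(w)/(2·log⁷ n · log p_n) + 3.15·P_11(w)/(2·log⁶ n · log² p_n) ≥ (w − 2)⁴/(4·log⁸ n). -/
/-- `nthPrime n` is the n-th prime number, with `nthPrime 1 = 2`. -/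
noncomputable def nthPrime (n : ℕ) : ℕ := Nat.nth Nat.Prime (n - 1)

theorem nthPrime_eq_of_count {m p : ℕ} (hp : p.Prime) (hc : Nat.count Nat.Prime p = m) :
    nthPrime (m + 1) = p := by
  subst hc
  exact Nat.nth_count hp

theorem nthPrime_prime (n : ℕ) : (nthPrime n).Prime := Nat.prime_nth_prime _

theorem nthPrime_mono : Monotone nthPrime := fun _ _ h =>
  (Nat.nth_le_nth Nat.infinite_setOfPred_prime).2 (Nat.sub_le_sub_right h 1)

theorem primeCounting_nthPrime {n : ℕ} (hn : 1 ≤ n) : (nthPrime n).primeCounting = n := by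
  have := Nat.count_nth_succ_of_infinite Nat.infinite_setOfPred_prime (n - 1)
  rw [Nat.sub_add_cancel hn] at this
  exact this

theorem sqrt_mul_log_lt_chebyshev {x : ℝ} (hx : 64 ≤ x) :
    √x * Real.log x < x * Real.log 2 - Real.log (x + 1) := by
  have hx0 : 0 < x := by linarith
  obtain ⟨s, hs⟩ : ∃ s, s = √x := ⟨_, rfl⟩
  have hsx : x = s ^ 2 := by rw [hs, Real.sq_sqrt hx0.le]
  have hs8 : 8 ≤ s := by
    rw [hs]; exact Real.le_sqrt_of_sq_le (by linarith)
  have hs0 : 0 < s := by linarith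
  have hlog8 : Real.log 8 = 3 * Real.log 2 := by
    rw [show (8 : ℝ) = 2 ^ 3 by norm_num, Real.log_pow]; norm_num
  have hlogs : Real.log s ≤ s / 8 - 1 + 3 * Real.log 2 := by
    have := Real.log_le_sub_one_of_pos (show 0 < s / 8 by positivity)
    rw [Real.log_div hs0.ne' (by norm_num), hlog8] at this
    linarith
  have hlogx : Real.log x = 2 * Real.log s := by rw [hsx, Real.log_pow]; norm_num
  have hlogx1 : Real.log (x + 1) ≤ Real.log x + 1 := by
    have := Real.log_le_log (by linarith) (show x + 1 ≤ x * Real.exp 1 by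
      nlinarith [Real.add_one_le_exp (1 : ℝ)])
    rwa [Real.log_mul hx0.ne' (Real.exp_pos 1).ne', Real.log_exp] at this
  have h2 := Real.log_two_gt_d9
  have h2' := Real.log_two_lt_d9
  rw [← hs]
  have hlin : Real.log x ≤ s / 4 + 2.16 := by linarith
  have h3 : s * Real.log x ≤ s * (s / 4 + 2.16) := by gcongr
  have h4 : s ^ 2 * 0.693 ≤ x * Real.log 2 := by rw [hsx]; gcongr; linarith
  nlinarith

theorem nthPrime_le_sq {n : ℕ} (hn : 21 ≤ n) : nthPrime n ≤ n ^ 2 := by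
  by_contra! h
  have h73 : 73 ≤ nthPrime n := by
    rw [← nthPrime_eq_of_count (m := 20) (p := 73) (by norm_num) (by decide)]
    exact nthPrime_mono hn
  have hx : (64 : ℝ) ≤ nthPrime n := by exact_mod_cast (by omega : 64 ≤ nthPrime n)
  have h1 := Chebyshev.psi_ge (nthPrime n)
  have h2 := Chebyshev.psi_le_primeCounting_mul_log (nthPrime n)
  rw [primeCounting_nthPrime (by omega)] at h2
  have h3 := sqrt_mul_log_lt_chebyshev hx
  have h4 : (n : ℝ) ≤ √(nthPrime n) := Real.le_sqrt_of_sq_le (by exact_mod_cast h.le)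
  have h5 : (n : ℝ) * Real.log (nthPrime n) ≤ √(nthPrime n) * Real.log (nthPrime n) := by
    gcongr
  linarith

theorem log_le_div_mul_log_of_pow_le {p n a b : ℕ} (hp : 0 < p) (hb : 0 < b)
    (h : p ^ b ≤ n ^ a) : Real.log p ≤ (a / b : ℝ) * Real.log n := by
  have h1 : Real.log ((p : ℝ) ^ b) ≤ Real.log ((n : ℝ) ^ a) :=
    Real.log_le_log (by positivity) (by exact_mod_cast h)
  rw [Real.log_pow, Real.log_pow] at h1
  rw [div_mul_eq_mul_div, le_div_iff₀ (by exact_mod_cast hb)]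
  linarith

theorem exp_div_le_of_pow_le {a b : ℕ} {c : ℝ} (hb : b ≠ 0) (hc : 0 ≤ c)
    (h : (2.7182818286 : ℝ) ^ a ≤ c ^ b) : Real.exp (a / b) ≤ c := by
  refine le_of_pow_le_pow_left₀ hb hc (le_trans ?_ h)
  have hb' : (b : ℝ) ≠ 0 := by exact_mod_cast hb
  rw [← Real.exp_nat_mul, mul_div_cancel₀ _ hb', ← mul_one (a : ℝ), Real.exp_nat_mul]
  gcongr
  exact Real.exp_one_lt_d9.le

theorem le_log_log {a b x : ℝ} (ha : Real.exp a ≤ b) (hb : Real.exp b ≤ x) :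
    a ≤ Real.log (Real.log x) := by
  have hb' : b ≤ Real.log x := (Real.le_log_iff_exp_le ((Real.exp_pos b).trans_le hb)).2 hb
  exact (Real.le_log_iff_exp_le ((Real.exp_pos a).trans_le (ha.trans hb'))).2 (ha.trans hb')

theorem quotient_bound_of_le_mul {y z C w A B : ℝ} (hy : 0 < y) (hz : 0 < z) (hzC : z ≤ C * y)
    (hB : 0 ≤ B) (h : C * w ^ 4 ≤ A + B / C) :
    w ^ 4 / (4 * y ^ 8) ≤ A / (4 * y ^ 7 * z) + B / (4 * y ^ 6 * z ^ 2) := by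
  have hC : 0 < C := pos_of_mul_pos_left (hz.trans_le hzC) hy.le
  have h1 : B / C ≤ B * y / z := by
    rw [div_le_div_iff₀ hC hz]
    nlinarith [mul_le_mul_of_nonneg_left hzC hB]
  have h2 : z / y * w ^ 4 ≤ C * w ^ 4 := by
    gcongr
    rwa [div_le_iff₀ hy]
  have h3 : A / (4 * y ^ 7 * z) + B / (4 * y ^ 6 * z ^ 2) = (A + B * y / z) / (4 * y ^ 7 * z) := by
    field_simp
  have h4 : w ^ 4 / (4 * y ^ 8) = (z / y * w ^ 4) / (4 * y ^ 7 * z) := by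
    field_simp
  rw [h3, h4]
  gcongr
  linarith

theorem exists_log_nthPrime_bound {n : ℕ} (hn : 17 ≤ n) :
    ∃ C w₀ : ℝ, Real.log (nthPrime n) ≤ C * Real.log n ∧ w₀ ≤ Real.log (Real.log n) ∧
      ((C = 29 / 20 ∧ w₀ = 26 / 25) ∨ (C = 2 ∧ w₀ = 111 / 100)) := by
  by_cases h21 : 21 ≤ n
  · refine ⟨2, 111 / 100, ?_, ?_, Or.inr ⟨rfl, rfl⟩⟩
    · have := log_le_div_mul_log_of_pow_le (p := nthPrime n) (n := n) (a := 2) (b := 1)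
        (nthPrime_prime n).pos one_pos (by simpa using nthPrime_le_sq h21)
      simpa using this
    · refine le_log_log (b := 3.04) ?_ (le_trans ?_ (show (21 : ℝ) ≤ n by exact_mod_cast h21))
      · have := exp_div_le_of_pow_le (a := 111) (b := 100) (c := 3.04) (by norm_num) (by norm_num)
          (by norm_num)
        norm_num at this ⊢
        exact this
      · have := exp_div_le_of_pow_le (a := 76) (b := 25) (c := 21) (by norm_num) (by norm_num)
          (by norm_num)
        norm_num at this ⊢
        exact this
  · refine ⟨29 / 20, 26 / 25, ?_, ?_, Or.inl ⟨rfl, rfl⟩⟩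
    · have := log_le_div_mul_log_of_pow_le (p := nthPrime n) (n := n) (a := 29) (b := 20)
        (nthPrime_prime n).pos (by norm_num) (by
          obtain rfl | rfl | rfl | rfl : n = 17 ∨ n = 18 ∨ n = 19 ∨ n = 20 := by omega
          · rw [nthPrime_eq_of_count (m := 16) (p := 59) (by norm_num) (by decide)]; norm_num
          · rw [nthPrime_eq_of_count (m := 17) (p := 61) (by norm_num) (by decide)]; norm_num
          · rw [nthPrime_eq_of_count (m := 18) (p := 67) (by norm_num) (by decide)]; norm_num
          · rw [nthPrime_eq_of_count (m := 19) (p := 71) (by norm_num) (by decide)]; norm_num)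
      simpa using this
    · refine le_log_log (b := 133 / 47) ?_ (le_trans ?_ (show (17 : ℝ) ≤ n by exact_mod_cast hn))
      · have := exp_div_le_of_pow_le (a := 26) (b := 25) (c := 133 / 47) (by norm_num) (by norm_num)
          (by norm_num)
        norm_num at this ⊢
        exact this
      · have := exp_div_le_of_pow_le (a := 133) (b := 47) (c := 17) (by norm_num) (by norm_num)
          (by norm_num)
        norm_num at this ⊢
        exact this

theorem stmt15 (n : ℕ) (hn : 17 ≤ n)
    (P₉ : ℝ → ℝ) (hP₉ : P₉ = fun x : ℝ => x ^ 3 - 6 * x ^ 2 + 11.4 * x - 4.2)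
    (P₁₀ : ℝ → ℝ) (hP₁₀ : P₁₀ = fun x : ℝ => 2 * x ^ 3 - 7.2 * x ^ 2 + 8.4 * x - 4.41)
    (P₁₁ : ℝ → ℝ) (hP₁₁ : P₁₁ = fun x : ℝ => x ^ 3 - 4.2 * x ^ 2 + 4.41 * x)
    (P₁₂ : ℝ → ℝ) (hP₁₂ : P₁₂ = fun x : ℝ => 9.3 * x ^ 2 - 12.3 * x + 11.5) :
    P₉ (Real.log (Real.log n)) * P₁₂ (Real.log (Real.log n))
        / (4 * (Real.log n) ^ 7 * Real.log (nthPrime n))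
      + 12.85 * P₁₀ (Real.log (Real.log n)) / (2 * (Real.log n) ^ 7 * Real.log (nthPrime n))
      + 3.15 * P₁₁ (Real.log (Real.log n)) / (2 * (Real.log n) ^ 7 * Real.log (nthPrime n))
      + 3.15 * P₁₁ (Real.log (Real.log n))
          / (2 * (Real.log n) ^ 6 * (Real.log (nthPrime n)) ^ 2)
      ≥ (Real.log (Real.log n) - 2) ^ 4 / (4 * (Real.log n) ^ 8) := by
  subst hP₉ hP₁₀ hP₁₁ hP₁₂
  obtain ⟨C, w₀, hz, hw, hC⟩ := exists_log_nthPrime_bound hn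
  have hnR : (1 : ℝ) < n := by exact_mod_cast (by omega : 1 < n)
  have hp1 : (1 : ℝ) < nthPrime n := by exact_mod_cast (nthPrime_prime n).one_lt
  have hy := Real.log_pos hnR
  have hzpos := Real.log_pos hp1
  set y := Real.log n
  set z := Real.log (nthPrime n)
  set w := Real.log y
  have hw0 : 0 ≤ w := by rcases hC with ⟨-, rfl⟩ | ⟨-, rfl⟩ <;> linarith
  have key := quotient_bound_of_le_mul (w := w - 2)
    (A := (w ^ 3 - 6 * w ^ 2 + 11.4 * w - 4.2) * (9.3 * w ^ 2 - 12.3 * w + 11.5)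
      + 25.7 * (2 * w ^ 3 - 7.2 * w ^ 2 + 8.4 * w - 4.41)
      + 6.3 * (w ^ 3 - 4.2 * w ^ 2 + 4.41 * w))
    (B := 6.3 * (w ^ 3 - 4.2 * w ^ 2 + 4.41 * w)) hy hzpos hz
    (by nlinarith [mul_nonneg hw0 (sq_nonneg (w - 2.1))]) (by
      obtain ⟨t, ht⟩ : ∃ t, t = w - w₀ := ⟨_, rfl⟩
      have ht0 : 0 ≤ t := by linarith
      have htsq := mul_nonneg ht0 (sq_nonneg (t - 0.28))
      have ht3sq := mul_nonneg (pow_nonneg ht0 3) (sq_nonneg (t - 1.14))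
      have ht2 := pow_nonneg ht0 2
      have ht3 := pow_nonneg ht0 3
      have ht4 := pow_nonneg ht0 4
      rcases hC with ⟨rfl, rfl⟩ | ⟨rfl, rfl⟩
      · have hwt : w = 26 / 25 + t := by linarith
        rw [hwt]
        linarith
      · have hwt : w = 111 / 100 + t := by linarith
        rw [hwt]
        linarith)
  refine ge_iff_le.2 (key.trans (le_of_eq ?_))
  field_simp
  ring
end

section
/- For every real number x ≥ 1, the derivative of Φ satisfies Φ'(x) ≥ e^x + 3/4. -/
/-- The function Φ(x) = eˣ + x + log(1 + (x-1)/eˣ + (x-2.1)/e^{2x}). -/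
noncomputable def Phi (x : ℝ) : ℝ :=
  Real.exp x + x + Real.log (1 + (x - 1) / Real.exp x + (x - 2.1) / Real.exp (2 * x))

/-- The argument of the logarithm in `Phi` is positive for `x ≥ 1`. -/
lemma Phi_log_arg_pos {x : ℝ} (hx : 1 ≤ x) :
    0 < 1 + (x - 1) / Real.exp x + (x - 2.1) / Real.exp (2 * x) := by
  have hy : 1 + x + x ^ 2 / 2 ≤ Real.exp x := Real.quadratic_le_exp_of_nonneg (by linarith)
  have h2 : Real.exp (2 * x) = Real.exp x ^ 2 := by rw [← Real.exp_nat_mul]; norm_num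
  rw [h2]
  have hpos := Real.exp_pos x
  generalize Real.exp x = y at *
  have h : 1 + (x - 1) / y + (x - 2.1) / y ^ 2 = (y ^ 2 + (x - 1) * y + (x - 2.1)) / y ^ 2 := by
    field_simp
  rw [h]
  have : 2 ≤ y := by nlinarith
  apply div_pos _ (by positivity)
  norm_num
  nlinarith [mul_nonneg (sub_nonneg.2 hx) hpos.le]

lemma hasDerivAt_Phi {x : ℝ} (hx : 1 ≤ x) :
    HasDerivAt Phi (Real.exp x + 1 +
      ((2 - x) / Real.exp x + (5.2 - 2 * x) / Real.exp (2 * x)) /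
        (1 + (x - 1) / Real.exp x + (x - 2.1) / Real.exp (2 * x))) x := by
  have he := Real.hasDerivAt_exp x
  have he2 : HasDerivAt (fun t : ℝ => Real.exp (2 * t)) (Real.exp (2 * x) * (2 * 1)) x :=
    ((hasDerivAt_id x).const_mul 2).exp
  have h1 := ((hasDerivAt_id x).sub_const 1).fun_div he (Real.exp_ne_zero x)
  have h2 := ((hasDerivAt_id x).sub_const 2.1).fun_div he2 (Real.exp_ne_zero (2 * x))
  have hA := ((h1.const_add 1).fun_add h2).log (Phi_log_arg_pos hx).ne'
  refine ((he.fun_add (hasDerivAt_id x)).fun_add hA).congr_deriv ?_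
  have hp := Real.exp_ne_zero x
  have hq := Real.exp_ne_zero (2 * x)
  congr 1
  simp only [id]
  congr 1
  field_simp
  ring

theorem stmt16 (x : ℝ) (hx : 1 ≤ x) :
    deriv Phi x ≥ Real.exp x + 3 / 4 := by
  rw [(hasDerivAt_Phi hx).deriv]
  have hA := Phi_log_arg_pos hx
  suffices h : -(1 / 4) ≤ ((2 - x) / Real.exp x + (5.2 - 2 * x) / Real.exp (2 * x)) /
      (1 + (x - 1) / Real.exp x + (x - 2.1) / Real.exp (2 * x)) by linarith
  rw [le_div_iff₀ hA]
  have hy : 1 + x + x ^ 2 / 2 ≤ Real.exp x := Real.quadratic_le_exp_of_nonneg (by linarith)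
  have h2 : Real.exp (2 * x) = Real.exp x ^ 2 := by rw [← Real.exp_nat_mul]; norm_num
  have hpos := Real.exp_pos x
  rw [h2]
  clear hA h2
  generalize Real.exp x = y at *
  have key : 0 ≤ (y ^ 2 + (7 - 3 * x) * y + (18.7 - 7 * x)) / (4 * y ^ 2) := by
    apply div_nonneg _ (by positivity)
    have h6 : 0 ≤ y + 7 - 3 * x - 6 := by nlinarith [sq_nonneg (x - 2)]
    norm_num
    nlinarith [mul_nonneg h6 hpos.le]
  have h : (2 - x) / y + (5.2 - 2 * x) / y ^ 2 -
      -(1 / 4) * (1 + (x - 1) / y + (x - 2.1) / y ^ 2) =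
      (y ^ 2 + (7 - 3 * x) * y + (18.7 - 7 * x)) / (4 * y ^ 2) := by
    field_simp
    ring
  linarith
end
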